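/- Let P ⊆ ℝ² be the convex hull of the five points (cos(2πk/5), sin(2πk/5)) for k = 0,1,2,3,4 (a regular pentagon). Then every convex quadrilateral Q with P ⊆ Q satisfies |Q| ≥ (3/√5)·|P|. -/

import Mathlib

open MeasureTheory Real

/-- A convex `n`-gon in the plane: the convex hull of a finite set of at most `n` points,
having nonempty interior. -/
def IsConvexPolygon (n : ℕ) (Q : Set (ℝ × ℝ)) : Prop :=
  ∃ S : Finset (ℝ × ℝ), S.card ≤ n ∧ Q = convexHull ℝ (S : Set (ℝ × ℝ)) ∧
    (interior Q).Nonempty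

theorem golden_bounds {g : ℝ} (hg : g ^ 2 = 1 - g) (h0 : 0 < g) :
    0.618 < g ∧ g < 0.6181 := by
  constructor <;> nlinarith

/-- A lower bound for a sum from one for a product, by the AM-GM inequality. -/
theorem two_mul_le_add_of_sq_le {g x y : ℝ} (hx : 0 ≤ x) (hy : 0 ≤ y)
    (h : (1 + g) ^ 2 ≤ (1 + x) * (1 + y)) : 2 * g ≤ x + y := by
  nlinarith [sq_nonneg (x - y)]

theorem pair_pair_bound {g a b c d : ℝ} (hg : g ^ 2 = 1 - g) (h0 : 0 < g)
    (ha : 0 ≤ a) (hb : 0 ≤ b) (hc : 0 ≤ c) (hd : 0 ≤ d)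
    (h : (1 - g * b + a) * (1 - g * c + d) ≤ b * c) : 2 * g ≤ a + b + c + d := by
  obtain ⟨hg1, hg2⟩ := golden_bounds hg h0
  by_contra! hlt
  have hb' : 0 < 1 - g * b := by nlinarith
  have hc' : 0 < 1 - g * c := by nlinarith
  have h1 : (1 - g * b) * (1 - g * c) ≤ b * c := by
    nlinarith [mul_nonneg ha hd, mul_nonneg ha hc'.le, mul_nonneg hb'.le hd]
  have h2 : g * (1 + g) ^ 2 ≤ g * ((1 + b) * (1 + c)) := by
    have e1 : g * (1 + g) ^ 2 = 1 + g := by linear_combination (g + 1) * hg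
    nlinarith
  have := two_mul_le_add_of_sq_le hb hc (le_of_mul_le_mul_left h2 h0)
  linarith

theorem three_term_bound {g b h k : ℝ} (hg : g ^ 2 = 1 - g) (h0 : 0 < g)
    (hb : 0 ≤ b) (hh : 0 ≤ h) (hk : 0 ≤ k) (hlt : b + h + k < 2 * g)
    (hM : 0 < 1 - g * b - g * h - g * b * h) :
    k * (g + h * (1 - g * b) / (1 - g * b - g * h - g * b * h)) < 1 := by
  obtain ⟨hg1, hg2⟩ := golden_bounds hg h0
  have hN : 0 < 1 - g * b := by nlinarith
  have hpos : 0 < g * (1 - g * b - g * h - g * b * h) + h * (1 - g * b) := by positivity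
  have key : (2 * g - b - h) * (g * (1 - g * b - g * h - g * b * h) + h * (1 - g * b))
      ≤ 1 - g * b - g * h - g * b * h := by
    have hR : 0 ≤ g * ((h - g) ^ 2 + ((1 + g) * (1 + h) - 1) * (b * (2 * g - h - b))) := by
      have : 0 ≤ b * (2 * g - h - b) := mul_nonneg hb (by linarith)
      have : 0 ≤ (1 + g) * (1 + h) - 1 := by nlinarith [mul_nonneg h0.le hh]
      positivity
    linear_combination hR + (1 + g + b * h + h ^ 2 - 2 * g * h) * hg
  have : g + h * (1 - g * b) / (1 - g * b - g * h - g * b * h) =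
    (g * (1 - g * b - g * h - g * b * h) + h * (1 - g * b)) / (1 - g * b - g * h - g * b * h) := by
    rw [add_div, mul_div_cancel_right₀ _ hM.ne']
  rw [this, mul_div_assoc', div_lt_one hM]
  refine lt_of_lt_of_le ?_ key
  exact mul_lt_mul_of_pos_right (by linarith) hpos

theorem chain_bound_aux {g a b h k l : ℝ} (hg : g ^ 2 = 1 - g) (h0 : 0 < g)
    (ha : 0 ≤ a) (hb : 0 ≤ b) (hh : 0 ≤ h) (hk : 0 ≤ k) (hl : 0 ≤ l)
    (hle : a + l ≤ b + h) (hlt : a + b + h + k + l < 2 * g) :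
    k * (g + h * (1 - g * b) / (1 - g * b - g * h - g * b * h)
      + l * (1 - g * a) / (1 - g * a - g * l - g * a * l)) < 1 := by
  obtain ⟨hg1, hg2⟩ := golden_bounds hg h0
  have hM : ∀ x y : ℝ, 0 ≤ x → 0 ≤ y → x + y < 2 * g → 0 < 1 - g * x - g * y - g * x * y := by
    intro x y hx hy hxy
    have : (x + y) ^ 2 < (2 * g) ^ 2 := by gcongr
    nlinarith [sq_nonneg (x - y)]
  have hM1 := hM b h hb hh (by linarith)
  have hM3 := hM a l ha hl (by linarith)
  have hMs := hM b (h + (a + l)) hb (by positivity) (by linarith)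
  have hN : 0 < 1 - g * b := by nlinarith
  have hN3 : 0 < 1 - g * (a + l) := by nlinarith
  have hS : a + l < g := by linarith
  have e1 : l * (1 - g * a) / (1 - g * a - g * l - g * a * l) ≤ (a + l) / (1 - g * (a + l)) := by
    rw [div_le_div_iff₀ hM3 hN3]
    have : 0 ≤ (1 - g * (a + l)) * (1 + g * l) - g * l * (a + l) := by
      have : g * (a + l) ≤ g * g := by gcongr
      nlinarith [mul_nonneg h0.le hl]
    nlinarith [mul_nonneg ha this]
  have hM2 := hM b (a + l) hb (by positivity) (by linarith)
  have e2 : (a + l) / (1 - g * (a + l)) ≤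
      (a + l) * (1 - g * b) / (1 - g * b - g * (a + l) - g * b * (a + l)) := by
    rw [div_le_div_iff₀ hN3 hM2]
    have : 0 ≤ b * (a + l) * (a + l) := by positivity
    nlinarith
  have e3 : h * (1 - g * b) / (1 - g * b - g * h - g * b * h) +
      (a + l) * (1 - g * b) / (1 - g * b - g * (a + l) - g * b * (a + l)) ≤
      (h + (a + l)) * (1 - g * b) / (1 - g * b - g * (h + (a + l)) - g * b * (h + (a + l))) := by
    rw [add_mul h (a + l), add_div (h * (1 - g * b))]
    have hal : 0 ≤ a + l := by positivity
    have hbal := mul_nonneg (mul_nonneg h0.le hb) hal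
    have hbh := mul_nonneg (mul_nonneg h0.le hb) hh
    apply add_le_add <;> apply div_le_div_of_nonneg_left _ hMs
    · nlinarith [mul_nonneg h0.le hal]
    · positivity
    · nlinarith [mul_nonneg h0.le hh]
    · positivity
  have := three_term_bound hg h0 hb (by positivity) hk (by linarith) hMs
  refine lt_of_le_of_lt ?_ this
  rw [add_assoc]
  exact mul_le_mul_of_nonneg_left (by linarith) hk

theorem chain_bound_of_elim {g a b h k l : ℝ} (hg : g ^ 2 = 1 - g) (h0 : 0 < g)
    (ha : 0 ≤ a) (hb : 0 ≤ b) (hh : 0 ≤ h) (hk : 0 ≤ k) (hl : 0 ≤ l)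
    (H : 0 < 1 - g * b - g * h - g * b * h → 0 < 1 - g * a - g * l - g * a * l →
      ∃ u v : ℝ, u + v = 1 - g * k ∧
      (1 - g * b - g * h - g * b * h) * u ≤ h * (1 - g * b) * k ∧
      (1 - g * a - g * l - g * a * l) * v ≤ l * (1 - g * a) * k) :
    2 * g ≤ a + b + h + k + l := by
  by_contra! hlt
  have hM : ∀ x y : ℝ, 0 ≤ x → 0 ≤ y → x + y < 2 * g → 0 < 1 - g * x - g * y - g * x * y := by
    intro x y hx hy hxy
    obtain ⟨hg1, hg2⟩ := golden_bounds hg h0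
    have : (x + y) ^ 2 < (2 * g) ^ 2 := by gcongr
    nlinarith [sq_nonneg (x - y)]
  have hM1 := hM b h hb hh (by linarith)
  have hM3 := hM a l ha hl (by linarith)
  obtain ⟨u, v, huv, hu, hv⟩ := H hM1 hM3
  have hu' : u ≤ h * (1 - g * b) / (1 - g * b - g * h - g * b * h) * k := by
    rw [div_mul_eq_mul_div, le_div_iff₀ hM1]; linarith
  have hv' : v ≤ l * (1 - g * a) / (1 - g * a - g * l - g * a * l) * k := by
    rw [div_mul_eq_mul_div, le_div_iff₀ hM3]; linarith
  rcases le_total (a + l) (b + h) with hle | hle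
  · have := chain_bound_aux hg h0 ha hb hh hk hl hle hlt
    linarith
  · have := chain_bound_aux hg h0 hb ha hl hk hh hle (by linarith)
    linarith

theorem chain_bound {g a b h k l s u v : ℝ} (hg : g ^ 2 = 1 - g) (h0 : 0 < g)
    (ha : 0 ≤ a) (hb : 0 ≤ b) (hh : 0 ≤ h) (hk : 0 ≤ k) (hl : 0 ≤ l)
    (h1 : (1 - g * b + a) * s ≤ b * h)
    (h2 : (1 - g * h - s) * u ≤ h * k)
    (h3 : (1 - g * k - u) * v ≤ k * l)
    (h4 : (1 - g * l - v) * (1 - g * a + b) ≤ l * a) :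
    2 * g ≤ a + b + h + k + l := by
  by_contra! hlt
  obtain ⟨hg1, hg2⟩ := golden_bounds hg h0
  have elim : ∀ {x y z s u : ℝ}, 0 ≤ x → 0 ≤ y → 0 ≤ z → 0 ≤ k → y < 2 * g →
      (1 - g * y + x) * s ≤ y * z → (1 - g * z - s) * u ≤ z * k →
      0 < 1 - g * y - g * z - g * y * z →
      (1 - g * y - g * z - g * y * z) * u ≤ z * (1 - g * y) * k := by
    intro x y z s u hx hy hz hk hlt h1 h2 hM
    have hN : 0 < 1 - g * y := by nlinarith
    have hs : (1 - g * y) * s ≤ y * z := by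
      rcases le_total s 0 with h | h
      · nlinarith [mul_nonneg hy hz, mul_nonneg hN.le (neg_nonneg.2 h)]
      · nlinarith [mul_nonneg hx h]
    rcases le_total u 0 with h | h
    · have : 0 ≤ z * (1 - g * y) * k := by positivity
      nlinarith [mul_nonneg hM.le (neg_nonneg.2 h)]
    · have e : 1 - g * y - g * z - g * y * z ≤ (1 - g * y) * (1 - g * z - s) := by
        linear_combination hs - y * z * hg
      calc _ ≤ (1 - g * y) * (1 - g * z - s) * u := by gcongr
        _ = (1 - g * y) * ((1 - g * z - s) * u) := by ring
        _ ≤ (1 - g * y) * (z * k) := by gcongr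
        _ = _ := by ring
  refine absurd (chain_bound_of_elim hg h0 ha hb hh hk hl fun hM1 hM3 ↦
    ⟨u, 1 - g * k - u, by ring, elim ha hb hh hk (by linarith) h1 h2 hM1, ?_⟩) hlt.not_ge
  exact elim (s := 1 - g * l - v) hb ha hl hk (by linarith) (by linarith)
    (by linarith) hM3

theorem pair_single_pair_bound {g a b c d k z : ℝ} (hg : g ^ 2 = 1 - g) (h0 : 0 < g)
    (ha : 0 ≤ a) (hb : 0 ≤ b) (hc : 0 ≤ c) (hd : 0 ≤ d) (hk : 0 ≤ k)
    (h1 : (1 - g * b + a) * z ≤ b * k)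
    (h2 : (1 - g * k - z) * (1 - g * c + d) ≤ k * c) : 2 * g ≤ a + b + c + d + k := by
  by_contra! hlt
  obtain ⟨hg1, hg2⟩ := golden_bounds hg h0
  have elim : ∀ {x y z : ℝ}, 0 ≤ x → 0 ≤ y → (1 - g * y + x) * z ≤ y * k →
      0 < 1 - g * y → (1 - g * y) * z ≤ y * k := by
    intro x y z hx hy h1 hN
    rcases le_total z 0 with h | h
    · nlinarith [mul_nonneg hy hk, mul_nonneg hN.le (neg_nonneg.2 h)]
    · nlinarith [mul_nonneg hx h]
  have := chain_bound_of_elim (a := 0) (b := 0) (h := b) (k := k) (l := c) hg h0 le_rfl le_rfl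
    hb hk hc fun hM1 hM3 ↦ ⟨z, 1 - g * k - z, by ring, by
      have := elim ha hb h1 (by linarith)
      linarith, by
      have := elim (z := 1 - g * k - z) hd hc (by linarith) (by linarith)
      linarith⟩
  linarith

/-- Twice the signed area of the triangle `p q r`. -/
def cross (p q r : ℝ × ℝ) : ℝ :=
  (q.1 - p.1) * (r.2 - p.2) - (q.2 - p.2) * (r.1 - p.1)

/-- The vertices of an affine regular pentagon, when `g` is the inverse golden ratio. -/
def vert (g : ℝ) : Fin 5 → ℝ × ℝ :=
  ![(0, 0), (1, 0), (1 + g, 1), (1, 1 + g), (0, 1)]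

/-- The affine forms defining the edges of the pentagon: form `j` vanishes at the vertices
`j` and `j + 1` and is nonnegative on the pentagon. -/
def edgeForm (g : ℝ) : Fin 5 → ℝ × ℝ → ℝ :=
  ![fun p ↦ p.2, fun p ↦ 1 - p.1 + g * p.2, fun p ↦ 1 + g - g * (p.1 + p.2),
    fun p ↦ 1 - p.2 + g * p.1, fun p ↦ p.1]

/-- The affine symmetry of the pentagon that sends the vertex `k + 1` to the vertex `k`. -/
def pentRot (g : ℝ) (p : ℝ × ℝ) : ℝ × ℝ := (p.2, 1 - p.1 + g * p.2)

/-- A closed quadrilateral, turning left, around the pentagon. -/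
structure Circumscribed (g : ℝ) (w : Fin 4 → ℝ × ℝ) : Prop where
  turn : ∀ i, 0 ≤ cross (w i) (w (i + 1)) (w (i + 2))
  side : ∀ i k, 0 ≤ cross (w i) (w (i + 1)) (vert g k)
  reach : ∀ j, ∃ i, edgeForm g j (w i) ≤ 0

/-- The corner `i` is extreme in the direction of the outer normal of the edge `j`. -/
def Extreme (g : ℝ) (w : Fin 4 → ℝ × ℝ) (i : Fin 4) (j : Fin 5) : Prop :=
  ∀ i', edgeForm g j (w i) ≤ edgeForm g j (w i')

theorem cross_pentRot {g : ℝ} (p q r : ℝ × ℝ) :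
    cross (pentRot g p) (pentRot g q) (pentRot g r) = cross p q r := by
  simp only [cross, pentRot]; ring

theorem pentRot_vert {g : ℝ} (hg : g ^ 2 = 1 - g) (k : Fin 5) :
    pentRot g (vert g (k + 1)) = vert g k := by
  fin_cases k <;> simp [pentRot, vert]
  linear_combination hg

theorem edgeForm_pentRot {g : ℝ} (hg : g ^ 2 = 1 - g) (j : Fin 5) (p : ℝ × ℝ) :
    edgeForm g j (pentRot g p) = edgeForm g (j + 1) p := by
  fin_cases j <;> simp [pentRot, edgeForm] <;> grind

theorem edgeForm_add_edgeForm {g : ℝ} (hg : g ^ 2 = 1 - g) (j : Fin 5) (p : ℝ × ℝ) :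
    edgeForm g j p + edgeForm g (j + 2) p = 1 + g * edgeForm g (j + 1) p := by
  fin_cases j <;> simp [edgeForm] <;> grind

theorem Circumscribed.pentRot {g : ℝ} (hg : g ^ 2 = 1 - g) {w : Fin 4 → ℝ × ℝ}
    (hw : Circumscribed g w) : Circumscribed g (fun i ↦ pentRot g (w i)) where
  turn i := by simpa only [cross_pentRot] using hw.turn i
  side i k := by
    rw [← pentRot_vert hg k, cross_pentRot]
    exact hw.side i (k + 1)
  reach j := by
    obtain ⟨i, hi⟩ := hw.reach (j + 1)
    exact ⟨i, by rwa [edgeForm_pentRot hg]⟩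

theorem Circumscribed.shift {g : ℝ} {w : Fin 4 → ℝ × ℝ}
    (hw : Circumscribed g w) (m : Fin 4) : Circumscribed g (fun i ↦ w (i + m)) where
  turn i := by simpa only [add_right_comm] using hw.turn (i + m)
  side i k := by simpa only [add_right_comm] using hw.side (i + m) k
  reach j := by
    obtain ⟨i, hi⟩ := hw.reach j
    exact ⟨i - m, by simpa using hi⟩

theorem extreme_pentRot {g : ℝ} (hg : g ^ 2 = 1 - g) {w : Fin 4 → ℝ × ℝ} {i : Fin 4}
    {j : Fin 5} :
    Extreme g (fun i ↦ pentRot g (w i)) i j ↔ Extreme g w i (j + 1) := by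
  simp only [Extreme, edgeForm_pentRot hg]

theorem extreme_shift {g : ℝ} {w : Fin 4 → ℝ × ℝ} {m i : Fin 4} {j : Fin 5} :
    Extreme g (fun i ↦ w (i + m)) i j ↔ Extreme g w (i + m) j :=
  ⟨fun h i' ↦ by simpa using h (i' - m), fun h i' ↦ h (i' + m)⟩

theorem exists_extreme (g : ℝ) (w : Fin 4 → ℝ × ℝ) (j : Fin 5) : ∃ i, Extreme g w i j :=
  Finite.exists_min fun i ↦ edgeForm g j (w i)

theorem cross_vert_succ {g : ℝ} (hg : g ^ 2 = 1 - g) (p q : ℝ × ℝ) (j : Fin 5) :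
    cross p q (vert g (j + 1)) =
      edgeForm g j p * edgeForm g (j + 1) q - edgeForm g (j + 1) p * edgeForm g j q := by
  fin_cases j <;> simp [edgeForm, cross, vert] <;> grind

theorem corner_unique_of_before {g x1 x2 y1 y2 : ℝ} (hg : g ^ 2 = 1 - g) (h0 : 0 < g)
    (hx1 : 0 ≤ x1) (hx2 : 0 ≤ x2) (hy1 : 0 ≤ y1) (hy2 : 0 ≤ y2)
    (hcr : 0 ≤ x1 * y2 - x2 * y1) (hq : g * y2 < y1) (hp : 0 < x1 + x2)
    (h1 : g * (y2 - x2) ≤ y1 - x1) (h2 : y1 + y2 ≤ x1 + x2) : x1 = y1 ∧ x2 = y2 := by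
  obtain ⟨hg1, hg2⟩ := golden_bounds hg h0
  have hD2 : y2 ≤ x2 := by nlinarith
  rcases lt_or_ge y1 x1 with h | h
  · exfalso
    have : y2 < x2 := by nlinarith
    nlinarith
  · rcases hD2.eq_or_lt with h' | h'
    · constructor <;> linarith
    · exfalso
      rcases hx1.eq_or_lt with h'' | h''
      · subst h''
        nlinarith
      · nlinarith

theorem Circumscribed.area_of_monotone {g : ℝ} (hg : g ^ 2 = 1 - g) (h0 : 0 < g)
    {w : Fin 4 → ℝ × ℝ} (hw : Circumscribed g w)
    (hN : ∀ i j, ¬ (Extreme g w i j ∧ Extreme g w i (j + 1) ∧ Extreme g w i (j + 2)))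
    (h4 : Extreme g w 0 4) (h5 : Extreme g w 0 0) {i₁ i₂ i₃ : Fin 4}
    (h1 : Extreme g w i₁ 1) (h2 : Extreme g w i₂ 2) (h3 : Extreme g w i₃ 3)
    (hi₁ : i₁ ≠ 0) (h12 : i₁ ≤ i₂) (h23 : i₂ ≤ i₃) :
    3 * (1 + g) ≤ cross (w 0) (w 1) (w 2) + cross (w 0) (w 2) (w 3) := by
  have nonpos {i : Fin 4} {j : Fin 5} (h : Extreme g w i j) : 0 ≤ -edgeForm g j (w i) := by
    obtain ⟨i', hi'⟩ := hw.reach j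
    linarith [h i']
  have side (i : Fin 4) (j : Fin 5) : edgeForm g (j + 1) (w i) * edgeForm g j (w (i + 1)) ≤
      edgeForm g j (w i) * edgeForm g (j + 1) (w (i + 1)) := by
    linarith [hw.side i (j + 1), cross_vert_succ hg (w i) (w (i + 1)) j]
  have rel := edgeForm_add_edgeForm hg
  have hcases : (i₁ = i₂ ∧ i₂ = i₃) ∨ (i₁ = 1 ∧ i₂ = 1 ∧ i₃ = 2) ∨ (i₁ = 1 ∧ i₂ = 1 ∧ i₃ = 3) ∨
      (i₁ = 1 ∧ i₂ = 2 ∧ i₃ = 2) ∨ (i₁ = 1 ∧ i₂ = 2 ∧ i₃ = 3) ∨ (i₁ = 1 ∧ i₂ = 3 ∧ i₃ = 3) ∨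
      (i₁ = 2 ∧ i₂ = 2 ∧ i₃ = 3) ∨ (i₁ = 2 ∧ i₂ = 3 ∧ i₃ = 3) := by
    clear h1 h2 h3
    decide +revert
  have s0 : edgeForm g 1 (w 0) * edgeForm g 0 (w 1) ≤
      edgeForm g 0 (w 0) * edgeForm g 1 (w 1) := side 0 0
  have s1 : edgeForm g 2 (w 1) * edgeForm g 1 (w 2) ≤
      edgeForm g 1 (w 1) * edgeForm g 2 (w 2) := side 1 1
  have s2 : edgeForm g 3 (w 2) * edgeForm g 2 (w 3) ≤
      edgeForm g 2 (w 2) * edgeForm g 3 (w 3) := side 2 2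
  have s3 : edgeForm g 4 (w 3) * edgeForm g 3 (w 0) ≤
      edgeForm g 3 (w 3) * edgeForm g 4 (w 0) := side 3 3
  have r01 : edgeForm g 0 (w 1) + edgeForm g 2 (w 1) = 1 + g * edgeForm g 1 (w 1) :=
    rel 0 (w 1)
  have r12 : edgeForm g 1 (w 2) + edgeForm g 3 (w 2) = 1 + g * edgeForm g 2 (w 2) :=
    rel 1 (w 2)
  have r23 : edgeForm g 2 (w 3) + edgeForm g 4 (w 3) = 1 + g * edgeForm g 3 (w 3) :=
    rel 2 (w 3)
  have r30 : edgeForm g 3 (w 0) + edgeForm g 0 (w 0) = 1 + g * edgeForm g 4 (w 0) :=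
    rel 3 (w 0)
  have r40 : edgeForm g 4 (w 0) + edgeForm g 1 (w 0) = 1 + g * edgeForm g 0 (w 0) :=
    rel 4 (w 0)
  have t01 : 0 ≤ cross (w 0) (w 1) (vert g 1) := hw.side 0 1
  have t11 : 0 ≤ cross (w 1) (w 2) (vert g 1) := hw.side 1 1
  have t12 : 0 ≤ cross (w 1) (w 2) (vert g 2) := hw.side 1 2
  have t13 : 0 ≤ cross (w 1) (w 2) (vert g 3) := hw.side 1 3
  have t22 : 0 ≤ cross (w 2) (w 3) (vert g 2) := hw.side 2 2
  have t23 : 0 ≤ cross (w 2) (w 3) (vert g 3) := hw.side 2 3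
  have t24 : 0 ≤ cross (w 2) (w 3) (vert g 4) := hw.side 2 4
  have t34 : 0 ≤ cross (w 3) (w 0) (vert g 4) := hw.side 3 4
  rcases hcases with ⟨rfl, rfl⟩ | ⟨rfl, rfl, rfl⟩ | ⟨rfl, rfl, rfl⟩ | ⟨rfl, rfl, rfl⟩ |
    ⟨rfl, rfl, rfl⟩ | ⟨rfl, rfl, rfl⟩ | ⟨rfl, rfl, rfl⟩ | ⟨rfl, rfl, rfl⟩
  · exact absurd ⟨h1, h2, h3⟩ (hN _ _)
  · have e : cross (w 0) (w 1) (w 2) + cross (w 0) (w 2) (w 3) = 3 + g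
        - edgeForm g 4 (w 0) - edgeForm g 0 (w 0) - edgeForm g 1 (w 1)
        - edgeForm g 2 (w 1) - edgeForm g 3 (w 2)
        + cross (w 0) (w 1) (vert g 1) + cross (w 1) (w 2) (vert g 3)
        + cross (w 2) (w 3) (vert g 4) + cross (w 3) (w 0) (vert g 4) := by
      simp [edgeForm, cross, vert]
      ring
    have := pair_pair_bound (a := -edgeForm g 4 (w 0)) (b := -edgeForm g 0 (w 0))
      (c := -edgeForm g 1 (w 1)) (d := -edgeForm g 2 (w 1)) hg h0
      (nonpos h4) (nonpos h5) (nonpos h1) (nonpos h2) (by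
        linear_combination s0 - edgeForm g 0 (w 1) * r40
          - (1 + g * edgeForm g 0 (w 0) - edgeForm g 4 (w 0)) * r01)
    linarith [nonpos h1, nonpos h2, nonpos h3, nonpos h4, nonpos h5,
      t01, t13, t24, t34]
  · have e : cross (w 0) (w 1) (w 2) + cross (w 0) (w 2) (w 3) = 3 + g
        - edgeForm g 4 (w 0) - edgeForm g 0 (w 0) - edgeForm g 1 (w 1)
        - edgeForm g 2 (w 1) - edgeForm g 3 (w 3)
        + cross (w 0) (w 1) (vert g 1) + cross (w 1) (w 2) (vert g 3)
        + cross (w 2) (w 3) (vert g 3) + cross (w 3) (w 0) (vert g 4) := by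
      simp [edgeForm, cross, vert]
      ring
    have := pair_pair_bound (a := -edgeForm g 4 (w 0)) (b := -edgeForm g 0 (w 0))
      (c := -edgeForm g 1 (w 1)) (d := -edgeForm g 2 (w 1)) hg h0
      (nonpos h4) (nonpos h5) (nonpos h1) (nonpos h2) (by
        linear_combination s0 - edgeForm g 0 (w 1) * r40
          - (1 + g * edgeForm g 0 (w 0) - edgeForm g 4 (w 0)) * r01)
    linarith [nonpos h1, nonpos h2, nonpos h3, nonpos h4, nonpos h5,
      t01, t13, t23, t34]
  · have e : cross (w 0) (w 1) (w 2) + cross (w 0) (w 2) (w 3) = 3 + g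
        - edgeForm g 4 (w 0) - edgeForm g 0 (w 0) - edgeForm g 1 (w 1)
        - edgeForm g 2 (w 2) - edgeForm g 3 (w 2)
        + cross (w 0) (w 1) (vert g 1) + cross (w 1) (w 2) (vert g 2)
        + cross (w 2) (w 3) (vert g 4) + cross (w 3) (w 0) (vert g 4) := by
      simp [edgeForm, cross, vert]
      ring
    have := pair_single_pair_bound (a := -edgeForm g 4 (w 0)) (b := -edgeForm g 0 (w 0))
      (c := -edgeForm g 2 (w 2)) (d := -edgeForm g 3 (w 2)) (k := -edgeForm g 1 (w 1))
      (z := edgeForm g 0 (w 1)) hg h0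
      (nonpos h4) (nonpos h5) (nonpos h2) (nonpos h3) (nonpos h1) (by
        linear_combination s0 - edgeForm g 0 (w 1) * r40) (by
        linear_combination s1 - edgeForm g 2 (w 1) * r12
          - (1 + g * edgeForm g 2 (w 2) - edgeForm g 3 (w 2)) * r01)
    linarith [nonpos h1, nonpos h2, nonpos h3, nonpos h4, nonpos h5,
      t01, t12, t24, t34]
  · have e : cross (w 0) (w 1) (w 2) + cross (w 0) (w 2) (w 3) = 3 + g
        - edgeForm g 4 (w 0) - edgeForm g 0 (w 0) - edgeForm g 1 (w 1)
        - edgeForm g 2 (w 2) - edgeForm g 3 (w 3)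
        + cross (w 0) (w 1) (vert g 1) + cross (w 1) (w 2) (vert g 2)
        + cross (w 2) (w 3) (vert g 3) + cross (w 3) (w 0) (vert g 4) := by
      simp [edgeForm, cross, vert]
      ring
    have := chain_bound (a := -edgeForm g 4 (w 0)) (b := -edgeForm g 0 (w 0))
      (h := -edgeForm g 1 (w 1)) (k := -edgeForm g 2 (w 2)) (l := -edgeForm g 3 (w 3))
      (s := edgeForm g 0 (w 1)) (u := edgeForm g 1 (w 2)) (v := edgeForm g 2 (w 3)) hg h0
      (nonpos h4) (nonpos h5) (nonpos h1) (nonpos h2) (nonpos h3)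
      (by linear_combination s0 - edgeForm g 0 (w 1) * r40)
      (by linear_combination s1 - edgeForm g 1 (w 2) * r01)
      (by linear_combination s2 - edgeForm g 2 (w 3) * r12)
      (by linear_combination s3 - edgeForm g 4 (w 3) * r30
          - (1 + g * edgeForm g 4 (w 0) - edgeForm g 0 (w 0)) * r23)
    linarith [nonpos h1, nonpos h2, nonpos h3, nonpos h4, nonpos h5,
      t01, t12, t23, t34]
  · have e : cross (w 0) (w 1) (w 2) + cross (w 0) (w 2) (w 3) = 3 + g
        - edgeForm g 4 (w 0) - edgeForm g 0 (w 0) - edgeForm g 1 (w 1)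
        - edgeForm g 2 (w 3) - edgeForm g 3 (w 3)
        + cross (w 0) (w 1) (vert g 1) + cross (w 1) (w 2) (vert g 2)
        + cross (w 2) (w 3) (vert g 2) + cross (w 3) (w 0) (vert g 4) := by
      simp [edgeForm, cross, vert]
      ring
    have := pair_pair_bound (a := -edgeForm g 0 (w 0)) (b := -edgeForm g 4 (w 0))
      (c := -edgeForm g 3 (w 3)) (d := -edgeForm g 2 (w 3)) hg h0
      (nonpos h5) (nonpos h4) (nonpos h3) (nonpos h2) (by
        linear_combination s3 - edgeForm g 4 (w 3) * r30
          - (1 + g * edgeForm g 4 (w 0) - edgeForm g 0 (w 0)) * r23)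
    linarith [nonpos h1, nonpos h2, nonpos h3, nonpos h4, nonpos h5,
      t01, t12, t22, t34]
  · have e : cross (w 0) (w 1) (w 2) + cross (w 0) (w 2) (w 3) = 3 + g
        - edgeForm g 4 (w 0) - edgeForm g 0 (w 0) - edgeForm g 1 (w 2)
        - edgeForm g 2 (w 2) - edgeForm g 3 (w 3)
        + cross (w 0) (w 1) (vert g 1) + cross (w 1) (w 2) (vert g 1)
        + cross (w 2) (w 3) (vert g 3) + cross (w 3) (w 0) (vert g 4) := by
      simp [edgeForm, cross, vert]
      ring
    have := pair_single_pair_bound (a := -edgeForm g 1 (w 2)) (b := -edgeForm g 2 (w 2))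
      (c := -edgeForm g 4 (w 0)) (d := -edgeForm g 0 (w 0)) (k := -edgeForm g 3 (w 3))
      (z := edgeForm g 2 (w 3)) hg h0
      (nonpos h1) (nonpos h2) (nonpos h4) (nonpos h5) (nonpos h3) (by
        linear_combination s2 - edgeForm g 2 (w 3) * r12) (by
        linear_combination s3 - edgeForm g 4 (w 3) * r30
          - (1 + g * edgeForm g 4 (w 0) - edgeForm g 0 (w 0)) * r23)
    linarith [nonpos h1, nonpos h2, nonpos h3, nonpos h4, nonpos h5,
      t01, t11, t23, t34]
  · have e : cross (w 0) (w 1) (w 2) + cross (w 0) (w 2) (w 3) = 3 + g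
        - edgeForm g 4 (w 0) - edgeForm g 0 (w 0) - edgeForm g 1 (w 2)
        - edgeForm g 2 (w 3) - edgeForm g 3 (w 3)
        + cross (w 0) (w 1) (vert g 1) + cross (w 1) (w 2) (vert g 1)
        + cross (w 2) (w 3) (vert g 2) + cross (w 3) (w 0) (vert g 4) := by
      simp [edgeForm, cross, vert]
      ring
    have := pair_pair_bound (a := -edgeForm g 0 (w 0)) (b := -edgeForm g 4 (w 0))
      (c := -edgeForm g 3 (w 3)) (d := -edgeForm g 2 (w 3)) hg h0
      (nonpos h5) (nonpos h4) (nonpos h3) (nonpos h2) (by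
        linear_combination s3 - edgeForm g 4 (w 3) * r30
          - (1 + g * edgeForm g 4 (w 0) - edgeForm g 0 (w 0)) * r23)
    linarith [nonpos h1, nonpos h2, nonpos h3, nonpos h4, nonpos h5,
      t01, t11, t22, t34]

theorem Circumscribed.area_of_extreme {g : ℝ} (hg : g ^ 2 = 1 - g) (h0 : 0 < g)
    {w : Fin 4 → ℝ × ℝ} (hw : Circumscribed g w)
    (hN : ∀ i j, ¬ (Extreme g w i j ∧ Extreme g w i (j + 1) ∧ Extreme g w i (j + 2)))
    (h4 : Extreme g w 0 4) (h5 : Extreme g w 0 0) :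
    3 * (1 + g) ≤ cross (w 0) (w 1) (w 2) + cross (w 0) (w 2) (w 3) := by
  have n1 : ¬ Extreme g w 0 1 := fun h ↦ hN 0 4 ⟨h4, h5, h⟩
  have n3 : ¬ Extreme g w 0 3 := fun h ↦ hN 0 3 ⟨h, h4, h5⟩
  have n2 : ¬ Extreme g w 0 2 := fun h ↦ hN 0 2 ⟨h, fun i ↦ by
    have := edgeForm_add_edgeForm hg 2 (w 0)
    have := edgeForm_add_edgeForm hg 2 (w i)
    have := h i
    have := h4 i
    simp only [Fin.reduceAdd] at *
    nlinarith, h4⟩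
  have lt {i : Fin 4} {j : Fin 5} (hi : Extreme g w i j) (hn : ¬ Extreme g w 0 j) :
      edgeForm g j (w i) < edgeForm g j (w 0) := by
    simp only [Extreme, not_forall, not_le] at hn
    obtain ⟨i', hi'⟩ := hn
    exact (hi i').trans_lt hi'
  have turn {p q : Fin 4} (hp : p ≠ 0) (hpq : p < q) : 0 ≤ cross (w 0) (w p) (w q) := by
    have : (p = 1 ∧ q = 2) ∨ (p = 2 ∧ q = 3) ∨ (p = 1 ∧ q = 3) := by
      decide +revert
    have t0 := hw.turn 0
    have t2 := hw.turn 2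
    have t3 := hw.turn 3
    simp only [cross, Fin.reduceAdd, zero_add] at *
    rcases this with ⟨rfl, rfl⟩ | ⟨rfl, rfl⟩ | ⟨rfl, rfl⟩ <;> linarith
  obtain ⟨i₁, h1⟩ := exists_extreme g w 1
  obtain ⟨i₂, h2⟩ := exists_extreme g w 2
  obtain ⟨i₃, h3⟩ := exists_extreme g w 3
  have ne {i : Fin 4} {j : Fin 5} (hi : Extreme g w i j) (hn : ¬ Extreme g w 0 j) : i ≠ 0 := by
    rintro rfl; exact hn hi
  obtain ⟨k₁, hk₁, hk₁'⟩ : ∃ k, Extreme g w k 1 ∧ k ≤ i₂ := by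
    rcases le_or_gt i₁ i₂ with h | h
    · exact ⟨i₁, h1, h⟩
    refine ⟨i₂, ?_, le_rfl⟩
    have hc := turn (ne h2 n2) h
    have l1 := lt h1 n1
    have l2 := lt h2 n2
    have l3 := h1 i₂
    have l4 := h2 i₁
    have a1 := h4 i₁
    have a2 := h4 i₂
    have b1 := h5 i₁
    have b2 := h5 i₂
    simp [edgeForm, cross] at hc l1 l2 l3 l4 a1 a2 b1 b2
    have := corner_unique_of_before hg h0 (sub_nonneg.2 a2) (sub_nonneg.2 b2)
      (sub_nonneg.2 a1) (sub_nonneg.2 b1) (by linarith) (by linarith) (by nlinarith)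
      (by linarith) (by nlinarith)
    have : w i₂ = w i₁ := by ext <;> linarith
    simpa only [Extreme, this] using h1
  obtain ⟨k₃, hk₃, hk₃'⟩ : ∃ k, Extreme g w k 3 ∧ i₂ ≤ k := by
    rcases le_or_gt i₂ i₃ with h | h
    · exact ⟨i₃, h3, h⟩
    refine ⟨i₂, ?_, le_rfl⟩
    have hc := turn (ne h3 n3) h
    have l1 := lt h3 n3
    have l2 := lt h2 n2
    have l3 := h3 i₂
    have l4 := h2 i₃
    have a1 := h4 i₃
    have a2 := h4 i₂
    have b1 := h5 i₃
    have b2 := h5 i₂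
    simp [edgeForm, cross] at hc l1 l2 l3 l4 a1 a2 b1 b2
    have := corner_unique_of_before hg h0 (sub_nonneg.2 b2) (sub_nonneg.2 a2)
      (sub_nonneg.2 b1) (sub_nonneg.2 a1) (by linarith) (by linarith) (by nlinarith)
      (by linarith) (by nlinarith)
    have : w i₂ = w i₃ := by ext <;> linarith
    simpa only [Extreme, this] using h3
  exact hw.area_of_monotone hg h0 hN h4 h5 hk₁ h2 hk₃ (ne hk₁ n1) hk₁' hk₃'

theorem Circumscribed.area {g : ℝ} (hg : g ^ 2 = 1 - g) (h0 : 0 < g)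
    {w : Fin 4 → ℝ × ℝ} (hw : Circumscribed g w)
    (hN : ∀ i j, ¬ (Extreme g w i j ∧ Extreme g w i (j + 1) ∧ Extreme g w i (j + 2))) :
    3 * (1 + g) ≤ cross (w 0) (w 1) (w 2) + cross (w 0) (w 2) (w 3) := by
  obtain ⟨i, j, hi, hj⟩ : ∃ i j, Extreme g w i j ∧ Extreme g w i (j + 1) := by
    choose f hf using exists_extreme g w
    obtain ⟨j, k, hjk, hfjk⟩ := Fintype.exists_ne_map_eq_of_card_lt f (by simp)
    have h2 (j : Fin 5) (h : f j = f (j + 2)) : Extreme g w (f j) (j + 1) := fun i ↦ by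
      have := edgeForm_add_edgeForm hg j (w i)
      have := edgeForm_add_edgeForm hg j (w (f j))
      have := hf j i
      have := hf (j + 2) i
      rw [← h] at this
      nlinarith
    have : k = j + 1 ∨ j = k + 1 ∨ k = j + 2 ∨ j = k + 2 := by
      clear hfjk
      decide +revert
    rcases this with rfl | rfl | rfl | rfl
    · exact ⟨f j, j, hf j, hfjk ▸ hf (j + 1)⟩
    · exact ⟨f k, k, hf k, hfjk ▸ hf (k + 1)⟩
    · exact ⟨f j, j, hf j, h2 j hfjk⟩
    · exact ⟨f k, k, hf k, h2 k hfjk.symm⟩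
  have step (v : Fin 4 → ℝ × ℝ) (hv : Circumscribed g v)
      (hNv : ∀ i j, ¬ (Extreme g v i j ∧ Extreme g v i (j + 1) ∧ Extreme g v i (j + 2)))
      (i : Fin 4) (h4 : Extreme g v i 4) (h0' : Extreme g v i 0) :
      3 * (1 + g) ≤ cross (v 0) (v 1) (v 2) + cross (v 0) (v 2) (v 3) := by
    have := (hv.shift i).area_of_extreme hg h0
      (fun i' j ↦ by simpa only [extreme_shift] using hNv (i' + i) j)
      (by simpa only [extreme_shift, zero_add] using h4)
      (by simpa only [extreme_shift, zero_add] using h0')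
    refine this.trans_eq ?_
    fin_cases i <;> simp [cross] <;> ring
  let Good (j : Fin 5) : Prop := ∀ v : Fin 4 → ℝ × ℝ, Circumscribed g v →
    (∀ i j, ¬ (Extreme g v i j ∧ Extreme g v i (j + 1) ∧ Extreme g v i (j + 2))) →
    ∀ i : Fin 4, Extreme g v i (j + 4) → Extreme g v i j →
    3 * (1 + g) ≤ cross (v 0) (v 1) (v 2) + cross (v 0) (v 2) (v 3)
  have good_zero : Good 0 := by simpa only [Good, zero_add] using step
  have good_succ (j : Fin 5) (ih : Good j) : Good (j + 1) := by
    intro v hv hNv i h4 h5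
    have := ih (fun i ↦ _root_.pentRot g (v i)) (hv.pentRot hg)
      (fun i j ↦ by
        simpa only [extreme_pentRot hg, add_right_comm] using hNv i (j + 1)) i
      (by rw [extreme_pentRot hg]; rwa [add_right_comm])
      (by rwa [extreme_pentRot hg])
    simpa only [cross_pentRot] using this
  have good : ∀ j, Good j := by
    have good_one := good_succ 0 good_zero
    have good_two := good_succ 1 good_one
    have good_three := good_succ 2 good_two
    have good_four := good_succ 3 good_three
    intro j
    fin_cases j
    exacts [good_zero, good_one, good_two, good_three, good_four]
  refine good (j + 1) w hw hN i ?_ hj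
  rw [add_assoc]
  simpa using hi

theorem cross_vert_vert_succ {g : ℝ} (hg : g ^ 2 = 1 - g) (p : ℝ × ℝ) (k : Fin 5) :
    cross p (vert g k) (vert g (k + 1)) = edgeForm g k p := by
  fin_cases k <;> simp [cross, vert, edgeForm] <;> grind

/-- A point beyond three consecutive edges of the pentagon spans a large quadrilateral with the
pentagon. -/
theorem area_of_beyond_three {g : ℝ} (hg : g ^ 2 = 1 - g) (h0 : 0 < g) {p : ℝ × ℝ} (j : Fin 5)
    (h1 : edgeForm g j p ≤ 0) (h2 : edgeForm g (j + 1) p ≤ 0) (h3 : edgeForm g (j + 2) p ≤ 0) :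
    0 ≤ cross p (vert g (j + 3)) (vert g (j + 4)) ∧ 0 ≤ cross p (vert g (j + 4)) (vert g j) ∧
    3 * (1 + g) ≤
      cross p (vert g (j + 3)) (vert g (j + 4)) + cross p (vert g (j + 4)) (vert g j) := by
  obtain ⟨hg1, hg2⟩ := golden_bounds hg h0
  obtain ⟨x, y⟩ := p
  have r := edgeForm_add_edgeForm hg
  have e := cross_vert_vert_succ hg (x, y)
  have a1 := r j (x, y)
  have a2 := r (j + 1) (x, y)
  have a3 := r (j + 4) (x, y)
  have e3 := e (j + 3)
  have e4 := e (j + 4)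
  simp only [add_assoc, Fin.reduceAdd, add_zero] at *
  rw [e3, e4]
  generalize edgeForm g j (x, y) = t0 at *
  generalize edgeForm g (j + 1) (x, y) = t1 at *
  generalize edgeForm g (j + 2) (x, y) = t2 at *
  generalize edgeForm g (j + 3) (x, y) = t3 at *
  generalize edgeForm g (j + 4) (x, y) = t4 at *
  have : t1 ≤ -(1 + g) := by nlinarith
  refine ⟨by nlinarith, by nlinarith, by nlinarith⟩

theorem lintegral_one_sub :
    ∫⁻ x in Set.Ioo (0 : ℝ) 1, ENNReal.ofReal (1 - x) = ENNReal.ofReal (1 / 2) := by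
  rw [← ofReal_integral_eq_lintegral_ofReal]
  · congr 1
    rw [← integral_Ioc_eq_integral_Ioo, ← intervalIntegral.integral_of_le zero_le_one]
    rw [intervalIntegral.integral_sub (by simp) (by simp)]
    norm_num
  · exact (continuous_const.sub continuous_id).integrableOn_Icc.mono_set Set.Ioo_subset_Icc_self
  · filter_upwards [ae_restrict_mem measurableSet_Ioo] with x hx
    exact sub_nonneg.2 hx.2.le

theorem volume_open_triangle :
    volume {t : ℝ × ℝ | 0 < t.1 ∧ 0 < t.2 ∧ t.1 + t.2 < 1} = ENNReal.ofReal (1 / 2) := by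
  have : {t : ℝ × ℝ | 0 < t.1 ∧ 0 < t.2 ∧ t.1 + t.2 < 1} =
      regionBetween (fun _ ↦ 0) (fun x ↦ 1 - x) (Set.Ioo (0 : ℝ) 1) := by
    ext ⟨x, y⟩
    simp only [regionBetween, Set.mem_ofPred_eq, Set.mem_Ioo]
    constructor
    · rintro ⟨h1, h2, h3⟩
      refine ⟨⟨h1, ?_⟩, h2, ?_⟩ <;> linarith
    · rintro ⟨⟨h1, h2⟩, h3, h4⟩
      refine ⟨h1, h3, ?_⟩; linarith
  rw [this, Measure.volume_eq_prod, volume_regionBetween_eq_lintegral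
    (by fun_prop) (by fun_prop) measurableSet_Ioo, ← lintegral_one_sub]
  simp

theorem volume_closed_triangle :
    volume {t : ℝ × ℝ | 0 ≤ t.1 ∧ 0 ≤ t.2 ∧ t.1 + t.2 ≤ 1} = ENNReal.ofReal (1 / 2) := by
  have hm : IsClosed {t : ℝ × ℝ | 0 ≤ t.1 ∧ 0 ≤ t.2 ∧ t.1 + t.2 ≤ 1} :=
    (isClosed_le continuous_const continuous_fst).inter
      ((isClosed_le continuous_const continuous_snd).inter
        (isClosed_le (continuous_fst.add continuous_snd) continuous_const))
  rw [Measure.volume_eq_prod, Measure.prod_apply hm.measurableSet, ← lintegral_one_sub,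
    setLIntegral_congr Ioo_ae_eq_Icc, ← lintegral_indicator measurableSet_Icc]
  congr 1 with x
  by_cases hx : x ∈ Set.Icc (0 : ℝ) 1
  · have : Prod.mk x ⁻¹' {t : ℝ × ℝ | 0 ≤ t.1 ∧ 0 ≤ t.2 ∧ t.1 + t.2 ≤ 1} = Set.Icc 0 (1 - x) := by
      ext y
      simp only [Set.mem_preimage, Set.mem_ofPred_eq, Set.mem_Icc, hx.1, true_and,
        le_sub_iff_add_le']
    rw [this, Set.indicator_of_mem hx, Real.volume_Icc, sub_zero]
  · have : Prod.mk x ⁻¹' {t : ℝ × ℝ | 0 ≤ t.1 ∧ 0 ≤ t.2 ∧ t.1 + t.2 ≤ 1} = ∅ := by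
      ext y
      simp only [Set.mem_preimage, Set.mem_ofPred_eq, Set.mem_empty_iff_false, iff_false]
      rintro ⟨h1, h2, h3⟩
      exact hx ⟨h1, by linarith⟩
    rw [this, Set.indicator_of_notMem hx, measure_empty]

/-- The affine map that sends `(0, 0)`, `(1, 0)`, `(0, 1)` to `p`, `q`, `r`. -/
def triMap (p q r t : ℝ × ℝ) : ℝ × ℝ := p + (t.1 • (q - p) + t.2 • (r - p))

theorem volume_image_triMap (p q r : ℝ × ℝ) (s : Set (ℝ × ℝ)) :
    volume (triMap p q r '' s) = ENNReal.ofReal |cross p q r| * volume s := by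
  let M : Matrix (Fin 2) (Fin 2) ℝ := !![q.1 - p.1, r.1 - p.1; q.2 - p.2, r.2 - p.2]
  let L := Matrix.toLin (Module.Basis.finTwoProd ℝ) (Module.Basis.finTwoProd ℝ) M
  have hL : triMap p q r = (fun z ↦ p + z) ∘ L := by
    funext t
    simp only [triMap, Function.comp, L, M, Matrix.toLin_finTwoProd_apply]
    ext <;> simp <;> ring
  rw [hL, Set.image_comp, Set.image_add_left, measure_preimage_add, Measure.addHaar_image_linearMap,
    LinearMap.det_toLin, Matrix.det_fin_two_of]
  congr 3
  simp only [cross]; ring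

theorem triMap_mem {Q : Set (ℝ × ℝ)} (hQ : Convex ℝ Q) {p q r t : ℝ × ℝ} (hp : p ∈ Q) (hq : q ∈ Q)
    (hr : r ∈ Q) (h1 : 0 ≤ t.1) (h2 : 0 ≤ t.2) (h3 : t.1 + t.2 ≤ 1) : triMap p q r t ∈ Q := by
  have := hQ.sum_mem (t := Finset.univ) (w := ![1 - t.1 - t.2, t.1, t.2]) (z := ![p, q, r])
    (by intro i _; fin_cases i <;> simp <;> linarith)
    (by simp [Fin.sum_univ_three]; ring) (by intro i _; fin_cases i <;> simpa)
  convert this using 1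
  simp only [triMap, Fin.sum_univ_three]
  ext <;> simp <;> ring

theorem volume_open_tri (p q r : ℝ × ℝ) (h : 0 ≤ cross p q r) :
    volume (triMap p q r '' {t : ℝ × ℝ | 0 < t.1 ∧ 0 < t.2 ∧ t.1 + t.2 < 1}) =
      ENNReal.ofReal (cross p q r / 2) := by
  rw [volume_image_triMap, volume_open_triangle, abs_of_nonneg h, ← ENNReal.ofReal_mul h]
  ring_nf

/-- A convex set that contains a quadrilateral is at least as large as that quadrilateral. -/
theorem ofReal_le_volume_of_mem {Q : Set (ℝ × ℝ)} (hQ : Convex ℝ Q) {p q r t : ℝ × ℝ}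
    (hp : p ∈ Q) (hq : q ∈ Q) (hr : r ∈ Q) (ht : t ∈ Q)
    (h1 : 0 ≤ cross p q r) (h2 : 0 ≤ cross p r t) :
    ENNReal.ofReal ((cross p q r + cross p r t) / 2) ≤ volume Q := by
  set T := {t : ℝ × ℝ | 0 < t.1 ∧ 0 < t.2 ∧ t.1 + t.2 < 1}
  have sub {q r : ℝ × ℝ} (hq : q ∈ Q) (hr : r ∈ Q) : triMap p q r '' T ⊆ Q := by
    rintro _ ⟨t, ⟨h1, h2, h3⟩, rfl⟩
    exact triMap_mem hQ hp hq hr h1.le h2.le h3.le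
  rcases h1.eq_or_lt with h | h
  · rw [← h, zero_add, ← volume_open_tri p r t h2]
    exact measure_mono (sub hr ht)
  have hH : MeasurableSet {z : ℝ × ℝ | 0 ≤ cross p r z} := by
    refine (isClosed_le continuous_const ?_).measurableSet
    unfold cross
    fun_prop
  rw [add_div, ENNReal.ofReal_add (by positivity) (by positivity), ← volume_open_tri p r t h2,
    ← volume_open_tri p q r h1, ← measure_inter_add_sdiff Q hH, add_comm]
  refine add_le_add (measure_mono ?_) (measure_mono ?_)
  · refine Set.subset_inter (sub hr ht) ?_
    rintro _ ⟨x, ⟨-, hx, -⟩, rfl⟩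
    have : cross p r (triMap p r t x) = x.2 * cross p r t := by
      simp [cross, triMap]; ring
    simpa only [Set.mem_ofPred_eq, this] using mul_nonneg hx.le h2
  · refine Set.subset_sdiff.2 ⟨sub hq hr, Set.disjoint_left.2 ?_⟩
    rintro _ ⟨x, ⟨hx, -, -⟩, rfl⟩
    have : cross p r (triMap p q r x) = -(x.1 * cross p q r) := by
      simp [cross, triMap]; ring
    simpa only [Set.mem_ofPred_eq, this, not_le, neg_lt_zero] using mul_pos hx h

/-- The points of `S` are contained in a closed polygon with at most four corners that turns
left and whose corners lie in the convex hull of `S`. -/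
def HasLeftTurningHull (S : Set (ℝ × ℝ)) : Prop :=
  ∃ w : Fin 4 → ℝ × ℝ, (∀ i, w i ∈ convexHull ℝ S) ∧ S ⊆ convexHull ℝ (Set.range w) ∧
    ∀ i, 0 ≤ cross (w i) (w (i + 1)) (w (i + 2))

theorem hasLeftTurningHull_of_cross_nonneg {p q r t : ℝ × ℝ} (h1 : 0 ≤ cross p q r)
    (h2 : 0 ≤ cross q r t) (h3 : 0 ≤ cross r t p) (h4 : 0 ≤ cross t p q) :
    HasLeftTurningHull {p, q, r, t} := by
  refine ⟨![p, q, r, t], fun i ↦ subset_convexHull ℝ _ ?_, ?_, fun i ↦ ?_⟩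
  · fin_cases i <;> simp
  · refine Set.Subset.trans ?_ (subset_convexHull ℝ _)
    rintro x (rfl | rfl | rfl | rfl)
    exacts [⟨0, rfl⟩, ⟨1, rfl⟩, ⟨2, rfl⟩, ⟨3, rfl⟩]
  · fin_cases i
    exacts [h1, h2, h3, h4]

theorem hasLeftTurningHull_of_mem_triangle {p q r z : ℝ × ℝ} (h : 0 < cross p q r)
    (h1 : 0 ≤ cross z q r) (h2 : 0 ≤ cross p z r) (h3 : 0 ≤ cross p q z) :
    HasLeftTurningHull {p, q, r, z} := by
  refine ⟨![p, q, r, r], fun i ↦ subset_convexHull ℝ _ ?_, ?_, fun i ↦ ?_⟩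
  · fin_cases i <;> simp
  · have hp : p ∈ convexHull ℝ (Set.range ![p, q, r, r]) := subset_convexHull ℝ _ ⟨0, rfl⟩
    have hq : q ∈ convexHull ℝ (Set.range ![p, q, r, r]) := subset_convexHull ℝ _ ⟨1, rfl⟩
    have hr : r ∈ convexHull ℝ (Set.range ![p, q, r, r]) := subset_convexHull ℝ _ ⟨2, rfl⟩
    have hz : z = triMap p q r (cross p z r / cross p q r, cross p q z / cross p q r) := by
      simp only [triMap]
      ext <;> simp <;> field_simp <;> simp only [cross] <;> ring
    rintro x (rfl | rfl | rfl | rfl)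
    · exact hp
    · exact hq
    · exact hr
    · rw [hz]
      refine triMap_mem (convex_convexHull ℝ _) hp hq hr (by positivity) (by positivity) ?_
      rw [← add_div, div_le_one h]
      simp only [cross] at *
      linarith
  · fin_cases i <;> simp [cross] at * <;> linarith

theorem hasLeftTurningHull (a b c d : ℝ × ℝ) : HasLeftTurningHull {a, b, c, d} := by
  have hs : cross c d a + cross a b c = cross b c d + cross d a b := by
    simp only [cross]; ring
  have e1 : ({a, b, c, d} : Set (ℝ × ℝ)) = {d, c, b, a} := by ext; simp; tauto
  have e2 : ({a, b, c, d} : Set (ℝ × ℝ)) = {a, c, b, d} := by ext; simp; tauto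
  have e3 : ({a, b, c, d} : Set (ℝ × ℝ)) = {d, b, c, a} := by ext; simp; tauto
  have e4 : ({a, b, c, d} : Set (ℝ × ℝ)) = {a, b, d, c} := by ext; simp; tauto
  have e5 : ({a, b, c, d} : Set (ℝ × ℝ)) = {c, d, b, a} := by ext; simp; tauto
  have e6 : ({a, b, c, d} : Set (ℝ × ℝ)) = {c, d, a, b} := by ext; simp; tauto
  have e7 : ({a, b, c, d} : Set (ℝ × ℝ)) = {a, d, c, b} := by ext; simp; tauto
  have e8 : ({a, b, c, d} : Set (ℝ × ℝ)) = {d, b, a, c} := by ext; simp; tauto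
  have e9 : ({a, b, c, d} : Set (ℝ × ℝ)) = {c, b, a, d} := by ext; simp; tauto
  have e10 : ({a, b, c, d} : Set (ℝ × ℝ)) = {b, c, d, a} := by ext; simp; tauto
  rcases le_total 0 (cross b c d) with s1 | s1 <;> rcases le_total 0 (cross c d a) with s2 | s2 <;>
    rcases le_total 0 (cross d a b) with s3 | s3 <;> rcases le_total 0 (cross a b c) with s4 | s4
  · apply hasLeftTurningHull_of_cross_nonneg <;> simp only [cross] at * <;> linarith
  · rcases le_or_gt (cross c d a) 0 with h | h
    · apply hasLeftTurningHull_of_cross_nonneg <;> simp only [cross] at * <;> linarith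
    · rw [e6]
      apply hasLeftTurningHull_of_mem_triangle h <;> simp only [cross] at * <;> linarith
  · rcases le_or_gt (cross b c d) 0 with h | h
    · apply hasLeftTurningHull_of_cross_nonneg <;> simp only [cross] at * <;> linarith
    · rw [e10]
      apply hasLeftTurningHull_of_mem_triangle h <;> simp only [cross] at * <;> linarith
  · rw [e5]
    apply hasLeftTurningHull_of_cross_nonneg <;> simp only [cross] at * <;> linarith
  · rcases le_or_gt (cross a b c) 0 with h | h
    · apply hasLeftTurningHull_of_cross_nonneg <;> simp only [cross] at * <;> linarith
    · apply hasLeftTurningHull_of_mem_triangle h <;> simp only [cross] at * <;> linarith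
  · apply hasLeftTurningHull_of_cross_nonneg <;> simp only [cross] at * <;> linarith
  · rw [e3]
    apply hasLeftTurningHull_of_cross_nonneg <;> simp only [cross] at * <;> linarith
  · rcases le_or_gt (cross d b a) 0 with h | h
    · rw [e1]
      apply hasLeftTurningHull_of_cross_nonneg <;> simp only [cross] at * <;> linarith
    · rw [e8]
      apply hasLeftTurningHull_of_mem_triangle h <;> simp only [cross] at * <;> linarith
  · rcases le_or_gt (cross a b d) 0 with h | h
    · apply hasLeftTurningHull_of_cross_nonneg <;> simp only [cross] at * <;> linarith
    · rw [e4]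
      apply hasLeftTurningHull_of_mem_triangle h <;> simp only [cross] at * <;> linarith
  · rw [e2]
    apply hasLeftTurningHull_of_cross_nonneg <;> simp only [cross] at * <;> linarith
  · apply hasLeftTurningHull_of_cross_nonneg <;> simp only [cross] at * <;> linarith
  · rcases le_or_gt (cross c b a) 0 with h | h
    · rw [e1]
      apply hasLeftTurningHull_of_cross_nonneg <;> simp only [cross] at * <;> linarith
    · rw [e9]
      apply hasLeftTurningHull_of_mem_triangle h <;> simp only [cross] at * <;> linarith
  · rw [e4]
    apply hasLeftTurningHull_of_cross_nonneg <;> simp only [cross] at * <;> linarith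
  · rcases le_or_gt (cross d c b) 0 with h | h
    · rw [e1]
      apply hasLeftTurningHull_of_cross_nonneg <;> simp only [cross] at * <;> linarith
    · rw [e1]
      apply hasLeftTurningHull_of_mem_triangle h <;> simp only [cross] at * <;> linarith
  · rcases le_or_gt (cross a d c) 0 with h | h
    · rw [e1]
      apply hasLeftTurningHull_of_cross_nonneg <;> simp only [cross] at * <;> linarith
    · rw [e7]
      apply hasLeftTurningHull_of_mem_triangle h <;> simp only [cross] at * <;> linarith
  · rw [e1]
    apply hasLeftTurningHull_of_cross_nonneg <;> simp only [cross] at * <;> linarith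

theorem cross_triMap (a b c p q r : ℝ × ℝ) :
    cross (triMap a b c p) (triMap a b c q) (triMap a b c r) = cross a b c * cross p q r := by
  simp [cross, triMap]; ring

theorem triMap_triMap (a b c p q r t : ℝ × ℝ) :
    triMap (triMap a b c p) (triMap a b c q) (triMap a b c r) t =
      triMap a b c (triMap p q r t) := by
  ext <;> simp [triMap] <;> ring

theorem exists_triMap_eq {a b c : ℝ × ℝ} (h : 0 < cross a b c) (z : ℝ × ℝ) :
    ∃ t, triMap a b c t = z := by
  refine ⟨(cross a z c / cross a b c, cross a b z / cross a b c), ?_⟩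
  simp only [triMap]
  ext <;> simp <;> field_simp <;> simp only [cross] <;> ring

theorem edgeForm_vert_nonneg {g : ℝ} (hg : g ^ 2 = 1 - g) (h0 : 0 < g) (j k : Fin 5) :
    0 ≤ edgeForm g j (vert g k) := by
  obtain ⟨hg1, hg2⟩ := golden_bounds hg h0
  fin_cases j <;> fin_cases k <;> simp [vert, edgeForm] <;> nlinarith

theorem edgeForm_vert_self {g : ℝ} (hg : g ^ 2 = 1 - g) (j : Fin 5) :
    edgeForm g j (vert g j) = 0 := by
  fin_cases j <;> simp [vert, edgeForm] <;> grind

theorem convex_cross_right (p q : ℝ × ℝ) : Convex ℝ {z | 0 ≤ cross p q z} := by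
  rintro x hx y hy s t hs ht hst
  simp only [Set.mem_ofPred_eq] at *
  have : cross p q (s • x + t • y) = s * cross p q x + t * cross p q y := by
    obtain rfl : s = 1 - t := by linarith
    simp [cross]; ring
  rw [this]
  positivity

theorem convex_cross_pos (p q : ℝ × ℝ) : Convex ℝ {z | 0 < cross z p q} := by
  rintro x hx y hy s t hs ht hst
  simp only [Set.mem_ofPred_eq] at *
  have : cross (s • x + t • y) p q = s * cross x p q + t * cross y p q := by
    obtain rfl : s = 1 - t := by linarith
    simp [cross]; ring
  rw [this]
  rcases hs.eq_or_lt with rfl | hs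
  · obtain rfl : t = 1 := by linarith
    simpa
  · have := mul_pos hs hx
    have := mul_nonneg ht hy.le
    linarith

/-- The vertices of the regular pentagon. -/
noncomputable def pent (k : Fin 5) : ℝ × ℝ := (cos (2 * π * k / 5), sin (2 * π * k / 5))

theorem exists_chart : ∃ (g : ℝ) (a b c : ℝ × ℝ), g ^ 2 = 1 - g ∧ 0 < g ∧ √5 = 2 * g + 1 ∧
    0 < cross a b c ∧ ∀ k, triMap a b c (vert g k) = pent k := by
  have h5 : √5 ^ 2 = 5 := sq_sqrt (by norm_num)
  have h5' : 1 < √5 := by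
    rw [lt_sqrt] <;> norm_num
  obtain ⟨g, hgd⟩ : ∃ g, g = (√5 - 1) / 2 := ⟨_, rfl⟩
  have hg : g ^ 2 = 1 - g := by rw [hgd]; linear_combination h5 / 4
  have h0 : 0 < g := by rw [hgd]; linarith
  have hs : √5 = 2 * g + 1 := by rw [hgd]; ring
  obtain ⟨hg1, hg2⟩ := golden_bounds hg h0
  have c1 : cos (2 * π / 5) = g / 2 := by
    rw [mul_div_assoc, cos_two_mul, cos_pi_div_five, hs]
    linear_combination hg / 2
  have s1 : 0 < sin (2 * π / 5) := sin_pos_of_pos_of_lt_pi (by positivity) (by linarith [pi_pos])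
  have e2 : 2 * π * 2 / 5 = 2 * (2 * π / 5) := by ring
  have c2 : cos (2 * π * 2 / 5) = -(1 + g) / 2 := by
    rw [e2, cos_two_mul, c1]
    linear_combination hg / 2
  have s2 : sin (2 * π * 2 / 5) = g * sin (2 * π / 5) := by
    rw [e2, sin_two_mul, c1]
    ring
  have e3 : 2 * π * 3 / 5 = 2 * π - 2 * π * 2 / 5 := by ring
  have e4 : 2 * π * 4 / 5 = 2 * π - 2 * π / 5 := by ring
  generalize hsin : sin (2 * π / 5) = s at *
  refine ⟨g, (1, 0), (g / 2, s), (g / 2, -s), hg, h0, hs, ?_, fun k ↦ ?_⟩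
  · simp [cross]
    nlinarith
  · fin_cases k
    · simp [triMap, vert, pent]
    · simp [triMap, vert, pent, c1, hsin]
    · simp [triMap, vert, pent, c2, s2]
      constructor <;> grind
    · simp [triMap, vert, pent, e3, cos_two_pi_sub, sin_two_pi_sub, c2, s2]
      constructor <;> grind
    · simp [triMap, vert, pent, e4, cos_two_pi_sub, sin_two_pi_sub, c1, hsin]

theorem volume_pentagon_le {g : ℝ} {a b c : ℝ × ℝ} (hg : g ^ 2 = 1 - g) (h0 : 0 < g)
    (hD : 0 < cross a b c) (hv : ∀ k, triMap a b c (vert g k) = pent k) :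
    volume (convexHull ℝ (Set.range pent)) ≤ ENNReal.ofReal (cross a b c * (3 + g) / 2) := by
  set T := {t : ℝ × ℝ | 0 ≤ t.1 ∧ 0 ≤ t.2 ∧ t.1 + t.2 ≤ 1} with hT
  obtain ⟨hg1, hg2⟩ := golden_bounds hg h0
  have vol (p q r : ℝ × ℝ) (h : 0 ≤ cross p q r) :
      volume (triMap (triMap a b c p) (triMap a b c q) (triMap a b c r) '' T) =
        ENNReal.ofReal (cross a b c * cross p q r / 2) := by
    rw [volume_image_triMap, hT, volume_closed_triangle, cross_triMap,
      abs_of_nonneg (by positivity), ← ENNReal.ofReal_mul (by positivity)]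
    ring_nf
  have c1 : cross (vert g 0) (vert g 1) (vert g 2) = 1 := by simp [cross, vert]
  have c2 : cross (vert g 0) (vert g 2) (vert g 3) = 1 + g := by simp [cross, vert]; grind
  have c3 : cross (vert g 0) (vert g 3) (vert g 4) = 1 := by simp [cross, vert]
  have sub : convexHull ℝ (Set.range pent) ⊆
      triMap (triMap a b c (vert g 0)) (triMap a b c (vert g 1)) (triMap a b c (vert g 2)) '' T ∪
      triMap (triMap a b c (vert g 0)) (triMap a b c (vert g 2)) (triMap a b c (vert g 3)) '' T ∪
      triMap (triMap a b c (vert g 0)) (triMap a b c (vert g 3)) (triMap a b c (vert g 4)) ''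
        T := by
    intro z hz
    obtain ⟨t, rfl⟩ := exists_triMap_eq hD z
    have ht (j : Fin 5) : 0 ≤ edgeForm g j t := by
      have : Set.range pent ⊆ {z | 0 ≤ cross (pent j) (pent (j + 1)) z} := by
        rintro _ ⟨k, rfl⟩
        have := mul_nonneg hD.le (edgeForm_vert_nonneg hg h0 j k)
        rw [← cross_vert_vert_succ hg, ← cross_triMap, hv, hv, hv] at this
        refine this.trans_eq ?_
        simp only [cross]; ring
      have := convexHull_min this (convex_cross_right _ _) hz
      rw [Set.mem_ofPred_eq, ← hv, ← hv, cross_triMap] at this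
      rw [← cross_vert_vert_succ hg]
      refine (nonneg_of_mul_nonneg_right this hD).trans_eq ?_
      simp only [cross]; ring
    have t0 := ht 0
    have t1 := ht 1
    have t2 := ht 2
    have t3 := ht 3
    have t4 := ht 4
    obtain ⟨x, y⟩ := t
    simp [edgeForm] at t0 t1 t2 t3 t4
    simp only [Set.mem_union, Set.mem_image, triMap_triMap]
    rcases le_total ((1 + g) * y) x with h | h
    · refine Or.inl (Or.inl ⟨(x - (1 + g) * y, y), ⟨?_, ?_, ?_⟩, ?_⟩)
      · simpa
      · simpa
      · simp; linarith
      · congr 1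
        simp [triMap, vert]; ring
    · rcases le_total ((1 + g) * x) y with h' | h'
      · refine Or.inr ⟨(x, y - (1 + g) * x), ⟨?_, ?_, ?_⟩, ?_⟩
        · simpa
        · simpa
        · simp; linarith
        · congr 1
          simp [triMap, vert]; ring
      · refine Or.inl (Or.inr ⟨(x - g * y, y - g * x), ⟨?_, ?_, ?_⟩, ?_⟩)
        · simp; nlinarith
        · simp; nlinarith
        · simp; nlinarith
        · congr 1
          simp [triMap, vert]
          constructor <;> grind
  refine (measure_mono sub).trans ((measure_union_le _ _).trans
    ((add_le_add_left (measure_union_le _ _) _).trans_eq ?_))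
  rw [vol _ _ _ (by rw [c1]; positivity), vol _ _ _ (by rw [c2]; positivity),
    vol _ _ _ (by rw [c3]; positivity), c1, c2, c3, ← ENNReal.ofReal_add (by positivity)
    (by positivity), ← ENNReal.ofReal_add (by positivity) (by positivity)]
  ring_nf

theorem ofReal_le_volume_of_pentagon_subset {g : ℝ} {a b c : ℝ × ℝ} (hg : g ^ 2 = 1 - g)
    (h0 : 0 < g) (hD : 0 < cross a b c) (hv : ∀ k, triMap a b c (vert g k) = pent k)
    {S : Set (ℝ × ℝ)} (hS : HasLeftTurningHull S) (hsub : Set.range pent ⊆ convexHull ℝ S) :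
    ENNReal.ofReal (cross a b c * (3 * (1 + g)) / 2) ≤ volume (convexHull ℝ S) := by
  obtain ⟨w', hwS, hSw, hturn⟩ := hS
  choose w hw using fun i ↦ exists_triMap_eq hD (w' i)
  obtain rfl : (fun i ↦ triMap a b c (w i)) = w' := funext hw
  have hmem (k : Fin 5) : triMap a b c (vert g k) ∈
      convexHull ℝ (Set.range fun i ↦ triMap a b c (w i)) :=
    convexHull_min hSw (convex_convexHull ℝ _) (hsub ⟨k, (hv k).symm⟩)
  have turn (i : Fin 4) : 0 ≤ cross (w i) (w (i + 1)) (w (i + 2)) := by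
    have := hturn i
    rw [cross_triMap] at this
    exact nonneg_of_mul_nonneg_right this hD
  have hcirc : Circumscribed g w := by
    refine ⟨turn, fun i k ↦ ?_, fun j ↦ ?_⟩
    · have : Set.range (fun i ↦ triMap a b c (w i)) ⊆
          {z | 0 ≤ cross (triMap a b c (w i)) (triMap a b c (w (i + 1))) z} := by
        rintro _ ⟨m, rfl⟩
        rw [Set.mem_ofPred_eq, cross_triMap]
        refine mul_nonneg hD.le ?_
        obtain ⟨l, rfl⟩ : ∃ l, m = i + l := ⟨m - i, by simp⟩
        have ht := turn i
        have ht' := turn (i + 3)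
        rw [add_assoc, add_assoc] at ht'
        fin_cases l
        · simp [cross]
        · simp [cross]; linarith
        · exact ht
        · simp [cross] at ht' ⊢; linarith
      have := convexHull_min this (convex_cross_right _ _) (hmem k)
      rw [Set.mem_ofPred_eq, cross_triMap] at this
      exact nonneg_of_mul_nonneg_right this hD
    · by_contra! hpos
      have : Set.range (fun i ↦ triMap a b c (w i)) ⊆
          {z | 0 < cross z (pent j) (pent (j + 1))} := by
        rintro _ ⟨m, rfl⟩
        rw [Set.mem_ofPred_eq, ← hv, ← hv, cross_triMap, cross_vert_vert_succ hg]
        exact mul_pos hD (hpos m)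
      have := convexHull_min this (convex_cross_pos _ _) (hmem j)
      rw [Set.mem_ofPred_eq, ← hv, ← hv, cross_triMap, cross_vert_vert_succ hg,
        edgeForm_vert_self hg] at this
      simp at this
  have key {p q r t : ℝ × ℝ} (hp : triMap a b c p ∈ convexHull ℝ S)
      (hq : triMap a b c q ∈ convexHull ℝ S) (hr : triMap a b c r ∈ convexHull ℝ S)
      (ht : triMap a b c t ∈ convexHull ℝ S) (h1 : 0 ≤ cross p q r) (h2 : 0 ≤ cross p r t)
      (h3 : 3 * (1 + g) ≤ cross p q r + cross p r t) :
      ENNReal.ofReal (cross a b c * (3 * (1 + g)) / 2) ≤ volume (convexHull ℝ S) := by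
    refine le_trans (ENNReal.ofReal_le_ofReal ?_) (ofReal_le_volume_of_mem (convex_convexHull ℝ S)
      hp hq hr ht (by rw [cross_triMap]; positivity) (by rw [cross_triMap]; positivity))
    rw [cross_triMap, cross_triMap, ← mul_add]
    gcongr
  have hvS (k : Fin 5) : triMap a b c (vert g k) ∈ convexHull ℝ S := hsub ⟨k, (hv k).symm⟩
  by_cases hN : ∃ i j, Extreme g w i j ∧ Extreme g w i (j + 1) ∧ Extreme g w i (j + 2)
  · obtain ⟨i, j, e1, e2, e3⟩ := hN
    have nonpos {j : Fin 5} (h : Extreme g w i j) : edgeForm g j (w i) ≤ 0 := by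
      obtain ⟨i', hi'⟩ := hcirc.reach j
      exact (h i').trans hi'
    obtain ⟨h1, h2, h3⟩ := area_of_beyond_three hg h0 j (nonpos e1) (nonpos e2) (nonpos e3)
    exact key (hwS i) (hvS _) (hvS _) (hvS _) h1 h2 h3
  · push Not at hN
    refine key (hwS 0) (hwS 1) (hwS 2) (hwS 3) (turn 0) ?_
      (hcirc.area hg h0 fun i j h ↦ hN i j h.1 h.2.1 h.2.2)
    have := turn 2
    simp only [cross, Fin.reduceAdd] at *
    linarith

theorem exists_eq_insert_of_card_le_four {S : Finset (ℝ × ℝ)} (hS : S.Nonempty)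
    (hcard : S.card ≤ 4) : ∃ a b c d, (S : Set (ℝ × ℝ)) = {a, b, c, d} := by
  have : Nonempty S := hS.coe_sort
  obtain ⟨e⟩ : Nonempty (S ↪ Fin 4) :=
    Function.Embedding.nonempty_of_card_le (by simpa using hcard)
  obtain ⟨f, hf⟩ : ∃ f : Fin 4 → S, Function.Surjective f :=
    ⟨Function.invFun e, Function.invFun_surjective e.injective⟩
  refine ⟨f 0, f 1, f 2, f 3, ?_⟩
  ext x
  constructor
  · intro hx
    obtain ⟨i, hi⟩ := hf ⟨x, hx⟩
    have : x = f i := by rw [hi]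
    fin_cases i <;> simp [this]
  · rintro (rfl | rfl | rfl | rfl) <;> exact (f _).2

/-- Every convex quadrilateral containing the regular pentagon has area at least
`3/√5` times the area of the pentagon. -/
theorem regular_pentagon_quadrilateral_lower_bound
    (P : Set (ℝ × ℝ))
    (hP : P = convexHull ℝ
      {p : ℝ × ℝ | ∃ k : Fin 5, p = (cos (2 * π * k / 5), sin (2 * π * k / 5))})
    (Q : Set (ℝ × ℝ)) (hQ : IsConvexPolygon 4 Q) (hPQ : P ⊆ Q) :
    ENNReal.ofReal (3 / Real.sqrt 5) * volume P ≤ volume Q := by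
  have hP' : P = convexHull ℝ (Set.range pent) := by
    rw [hP]
    congr 1
    ext p
    simp [pent, eq_comm]
  subst hP'
  obtain ⟨S, hcard, rfl, hne⟩ := hQ
  have hSne : S.Nonempty := by
    have := hne.mono interior_subset
    rwa [convexHull_nonempty_iff, Finset.coe_nonempty] at this
  obtain ⟨p, q, r, t, hS⟩ := exists_eq_insert_of_card_le_four hSne hcard
  obtain ⟨g, a, b, c, hg, h0, hs, hD, hv⟩ := exists_chart
  have hle := ofReal_le_volume_of_pentagon_subset hg h0 hD hv (hS ▸ hasLeftTurningHull p q r t)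
    ((subset_convexHull ℝ _).trans hPQ)
  refine le_trans ?_ hle
  refine (mul_le_mul_right (volume_pentagon_le hg h0 hD hv) _).trans_eq ?_
  rw [← ENNReal.ofReal_mul (by positivity), hs]
  congr 1
  field_simp
  linear_combination -2 * hg
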